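/- For a Markov chain choice model, let 𝒮 be a family of nonempty subsets of N, let S′ ⊆ N be nonempty, and let 𝒮′ := 𝒮 ∪ {S′}. Define V_𝒮 := Span{ h_{j,S} : S ∈ 𝒮, j ∈ S₊ }, V_{S′} := Span{ h_{j,S′} : j ∈ S′₊ }, and V_{𝒮′} := V_𝒮 + V_{S′}, where h_{j,S} := (π(j, S | k))_{k∈N₊} ∈ ℝ^{n+1}. Then dim(V_{𝒮′}) ≥ dim(V_𝒮) + |S′| − max{ 1, |(⋃_{S∈𝒮} S) ∩ S′| }. -/

import Mathlib

open Matrix Filter Finset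

/-- The product-by-product submatrix `ρ̃` of the transition matrix
(rows/columns indexed by the products `1,…,n`, i.e. the nonzero states). -/
def subRho {n : ℕ} (rho : Matrix (Fin (n+1)) (Fin (n+1)) ℝ) : Matrix (Fin n) (Fin n) ℝ :=
  Matrix.of fun i j => rho i.succ j.succ

/-- Markov chain choice model: `lam` is a probability vector on the states `{0,1,…,n}`,
`rho` is row-stochastic, state `0` (no purchase) is absorbing, there are no self-loops on
product states, and the product-by-product submatrix `ρ̃` is irreducible. -/
def IsMCCM {n : ℕ} (lam : Fin (n+1) → ℝ) (rho : Matrix (Fin (n+1)) (Fin (n+1)) ℝ) : Prop :=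
  (∀ i, 0 ≤ lam i) ∧ (∑ i, lam i = 1) ∧
  (∀ i j, 0 ≤ rho i j) ∧ (∀ i, ∑ j, rho i j = 1) ∧
  rho 0 0 = 1 ∧
  (∀ i : Fin (n+1), i ≠ 0 → rho i i = 0) ∧
  (∀ i j : Fin n, ∃ t : ℕ, 1 ≤ t ∧ 0 < (subRho rho ^ t) i j)

/-- `ρ^S`: the transition matrix with every row `i ∈ S` replaced by the `i`-th standard
basis vector, so that all states of `S ∪ {0}` are absorbing. -/
def absorb {n : ℕ} (rho : Matrix (Fin (n+1)) (Fin (n+1)) ℝ) (S : Finset (Fin (n+1))) :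
    Matrix (Fin (n+1)) (Fin (n+1)) ℝ :=
  Matrix.of fun i j => if i ∈ S then (if j = i then (1 : ℝ) else 0) else rho i j

/-- The conditional choice probability `π(j, S ∣ i) := lim_{t→∞} ((ρ^S)^t)_{i,j}`. -/
noncomputable def condProb {n : ℕ} (rho : Matrix (Fin (n+1)) (Fin (n+1)) ℝ)
    (S : Finset (Fin (n+1))) (i j : Fin (n+1)) : ℝ :=
  limUnder atTop fun t : ℕ => (absorb rho S ^ t) i j

/-- The choice probability `π(j, S) := ∑_{k ∈ N₊} λ_k · π(j, S ∣ k)`. -/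
noncomputable def choiceProb {n : ℕ} (lam : Fin (n+1) → ℝ)
    (rho : Matrix (Fin (n+1)) (Fin (n+1)) ℝ) (S : Finset (Fin (n+1))) (j : Fin (n+1)) : ℝ :=
  ∑ k, lam k * condProb rho S k j

/-- The vector `h_{j,S} = (π(j, S ∣ k))_{k ∈ N₊} ∈ ℝ^{n+1}`. -/
noncomputable def hvec {n : ℕ} (rho : Matrix (Fin (n+1)) (Fin (n+1)) ℝ)
    (S : Finset (Fin (n+1))) (j : Fin (n+1)) : Fin (n+1) → ℝ :=
  fun k => condProb rho S k j

section ChoiceModel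

variable {n : ℕ} {lam : Fin (n+1) → ℝ} {rho : Matrix (Fin (n+1)) (Fin (n+1)) ℝ}

/-- The functions on the state space that are harmonic at every state outside `T`. -/
def harmonicOff (rho : Matrix (Fin (n+1)) (Fin (n+1)) ℝ) (T : Finset (Fin (n+1))) :
    Submodule ℝ (Fin (n+1) → ℝ) where
  carrier := {f | ∀ k ∉ T, ∑ l, rho k l * f l = f k}
  add_mem' := by
    intro f g hf hg k hk
    simp [mul_add, Finset.sum_add_distrib, hf k hk, hg k hk]
  zero_mem' := by intro k _; simp
  smul_mem' := by
    intro c f hf k hk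
    simp only [Pi.smul_apply, smul_eq_mul]
    rw [← hf k hk, Finset.mul_sum]
    exact Finset.sum_congr rfl fun l _ => by ring

theorem harmonicOff_mono {S T : Finset (Fin (n+1))} (hST : S ⊆ T) :
    harmonicOff rho S ≤ harmonicOff rho T :=
  fun _ hf k hk => hf k fun hkS => hk (hST hkS)

theorem harmonicOff_inf_le (S T : Finset (Fin (n+1))) :
    harmonicOff rho S ⊓ harmonicOff rho T ≤ harmonicOff rho (S ∩ T) := by
  rintro f ⟨hS, hT⟩ k hk
  by_cases hkS : k ∈ S
  · exact hT k fun hkT => hk (Finset.mem_inter.2 ⟨hkS, hkT⟩)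
  · exact hS k hkS

theorem IsMCCM.nonneg (h : IsMCCM lam rho) (i j) : 0 ≤ rho i j := h.2.2.1 i j

theorem IsMCCM.row_sum (h : IsMCCM lam rho) (i) : ∑ j, rho i j = 1 := h.2.2.2.1 i

theorem IsMCCM.zero_zero (h : IsMCCM lam rho) : rho 0 0 = 1 := h.2.2.2.2.1

theorem IsMCCM.irreducible (h : IsMCCM lam rho) (i j : Fin n) :
    ∃ t : ℕ, 1 ≤ t ∧ 0 < (subRho rho ^ t) i j := h.2.2.2.2.2.2 i j

theorem IsMCCM.zero_row (h : IsMCCM lam rho) (j : Fin (n+1)) :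
    rho 0 j = if j = 0 then 1 else 0 := by
  split_ifs with hj
  · rw [hj, h.zero_zero]
  · have hs := h.row_sum 0
    rw [Fin.sum_univ_succ, h.zero_zero] at hs
    obtain ⟨i, rfl⟩ := Fin.exists_succ_eq.2 hj
    exact (Finset.sum_eq_zero_iff_of_nonneg fun i _ => h.nonneg 0 i.succ).1 (by linarith) i
      (Finset.mem_univ i)

theorem subRho_pow_nonneg (h : IsMCCM lam rho) (t : ℕ) (i j : Fin n) :
    0 ≤ (subRho rho ^ t) i j := by
  induction t generalizing j with
  | zero => rw [pow_zero, Matrix.one_apply]; split_ifs <;> norm_num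
  | succ t ih =>
    rw [pow_succ, Matrix.mul_apply]
    exact Finset.sum_nonneg fun k _ => mul_nonneg (ih k) (h.nonneg _ _)

/-- A set of states closed under one-step transitions between products is closed under
reachability. -/
theorem mem_of_subRho_pow_pos (h : IsMCCM lam rho) {B : Set (Fin (n+1))}
    (hB : ∀ k ∈ B, ∀ l, 0 < rho k l → l ∈ B) {i j : Fin n} (hi : i.succ ∈ B) {t : ℕ}
    (ht : 0 < (subRho rho ^ t) i j) : j.succ ∈ B := by
  induction t generalizing j with
  | zero =>
    rw [pow_zero, Matrix.one_apply] at ht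
    split_ifs at ht with hij
    · exact hij ▸ hi
    · exact absurd ht (lt_irrefl 0)
  | succ t ih =>
    rw [pow_succ, Matrix.mul_apply] at ht
    obtain ⟨k, -, hk⟩ := Finset.exists_ne_zero_of_sum_ne_zero ht.ne'
    have h1 := (subRho_pow_nonneg h t i k).lt_of_ne' (left_ne_zero_of_mul hk)
    exact hB _ (ih h1) _ ((h.nonneg k.succ j.succ).lt_of_ne' (right_ne_zero_of_mul hk))

/-- Maximum principle. -/
theorem nonpos_of_mem_harmonicOff (h : IsMCCM lam rho) {T : Finset (Fin (n+1))}
    (hT0 : (0 : Fin (n+1)) ∉ T) (hT : T.Nonempty) {f : Fin (n+1) → ℝ}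
    (hf : f ∈ harmonicOff rho T) (hfT : ∀ k ∈ insert 0 T, f k ≤ 0) (k : Fin (n+1)) :
    f k ≤ 0 := by
  obtain ⟨m, hm⟩ := Finite.exists_max f
  refine (hm k).trans (not_lt.1 fun hpos => ?_)
  have hout : ∀ i, f i = f m → i ∉ insert 0 T := fun i hi hiT =>
    (hfT i hiT).not_gt (hi ▸ hpos)
  have hclosed : ∀ i ∈ {i | f i = f m}, ∀ l, 0 < rho i l → l ∈ {i | f i = f m} := by
    intro i hi l hl
    have hiT : i ∉ T := fun hh => hout i hi (Finset.mem_insert_of_mem hh)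
    have hsum : ∑ l, rho i l * (f m - f l) = 0 := by
      simp only [mul_sub, Finset.sum_sub_distrib, ← Finset.sum_mul, h.row_sum, hf i hiT]
      rw [hi]; ring
    have hz := (Finset.sum_eq_zero_iff_of_nonneg fun l _ =>
      mul_nonneg (h.nonneg i l) (sub_nonneg.2 (hm l))).1 hsum l (Finset.mem_univ l)
    exact (sub_eq_zero.1 ((mul_eq_zero.1 hz).resolve_left hl.ne')).symm
  obtain ⟨a, ha⟩ := hT
  obtain ⟨a, rfl⟩ := Fin.exists_succ_eq.2 fun h0 => hT0 (h0 ▸ ha)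
  obtain ⟨i, rfl⟩ := Fin.exists_succ_eq.2 fun h0 =>
    hout m rfl (Finset.mem_insert.2 (Or.inl h0))
  obtain ⟨t, -, ht⟩ := h.irreducible i a
  exact hout _ (mem_of_subRho_pow_pos h hclosed rfl ht) (Finset.mem_insert_of_mem ha)

theorem eq_zero_of_mem_harmonicOff (h : IsMCCM lam rho) {T : Finset (Fin (n+1))}
    (hT0 : (0 : Fin (n+1)) ∉ T) (hT : T.Nonempty) {f : Fin (n+1) → ℝ}
    (hf : f ∈ harmonicOff rho T) (hfT : ∀ k ∈ insert 0 T, f k = 0) : f = 0 := by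
  funext k
  have h1 := nonpos_of_mem_harmonicOff h hT0 hT hf (fun k hk => (hfT k hk).le) k
  have h2 := nonpos_of_mem_harmonicOff h hT0 hT (Submodule.neg_mem _ hf)
    (fun k hk => by simp [hfT k hk]) k
  simp only [Pi.neg_apply, Pi.zero_apply] at *
  linarith

theorem finrank_harmonicOff_le (h : IsMCCM lam rho) {T : Finset (Fin (n+1))}
    (hT0 : (0 : Fin (n+1)) ∉ T) (hT : T.Nonempty) :
    Module.finrank ℝ (harmonicOff rho T) ≤ T.card + 1 := by
  let r : harmonicOff rho T →ₗ[ℝ] (↥(insert 0 T) → ℝ) :=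
    LinearMap.funLeft ℝ ℝ Subtype.val ∘ₗ (harmonicOff rho T).subtype
  have hr : Function.Injective r := by
    rw [← LinearMap.ker_eq_bot, LinearMap.ker_eq_bot']
    intro f hf
    exact Subtype.ext (eq_zero_of_mem_harmonicOff h hT0 hT f.2
      fun k hk => congrFun hf ⟨k, hk⟩)
  have := LinearMap.finrank_le_finrank_of_injective hr
  rwa [Module.finrank_fintype_fun_eq_card, Fintype.card_coe,
    Finset.card_insert_of_notMem hT0] at this

theorem finrank_harmonicOff_le_max (h : IsMCCM lam rho) (hn : 0 < n) {T : Finset (Fin (n+1))}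
    (hT0 : (0 : Fin (n+1)) ∉ T) :
    Module.finrank ℝ (harmonicOff rho T) ≤ max 1 T.card + 1 := by
  rcases T.eq_empty_or_nonempty with rfl | hT
  · let a : Fin (n+1) := Fin.succ ⟨0, hn⟩
    have ha : (0 : Fin (n+1)) ∉ ({a} : Finset (Fin (n+1))) := by
      simpa using (Fin.succ_ne_zero _).symm
    refine (Submodule.finrank_mono (harmonicOff_mono (Finset.empty_subset {a}))).trans ?_
    simpa using finrank_harmonicOff_le h ha (Finset.singleton_nonempty a)
  · exact (finrank_harmonicOff_le h hT0 hT).trans (by gcongr; exact le_max_right _ _)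

theorem absorb_apply_of_notMem {S : Finset (Fin (n+1))} {i : Fin (n+1)} (hi : i ∉ S)
    (j : Fin (n+1)) : absorb rho S i j = rho i j := by simp [absorb, hi]

theorem absorb_apply_of_mem (h : IsMCCM lam rho) {S : Finset (Fin (n+1))} {i : Fin (n+1)}
    (hi : i ∈ insert 0 S) (j : Fin (n+1)) : absorb rho S i j = if j = i then 1 else 0 := by
  by_cases hiS : i ∈ S
  · simp [absorb, hiS]
  · obtain rfl := (Finset.mem_insert.1 hi).resolve_right hiS
    rw [absorb_apply_of_notMem hiS, h.zero_row]

theorem absorb_mem_rowStochastic (h : IsMCCM lam rho) (S : Finset (Fin (n+1))) :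
    absorb rho S ∈ rowStochastic ℝ (Fin (n+1)) := by
  rw [mem_rowStochastic_iff_sum]
  refine ⟨fun i j => ?_, fun i => ?_⟩
  · simp only [absorb, Matrix.of_apply]
    split_ifs
    exacts [zero_le_one, le_rfl, h.nonneg i j]
  · by_cases hi : i ∈ S
    · simp [absorb, hi]
    · simp [absorb, hi, h.row_sum]

theorem absorb_pow_apply_of_mem (h : IsMCCM lam rho) {S : Finset (Fin (n+1))} {i : Fin (n+1)}
    (hi : i ∈ insert 0 S) (t : ℕ) (j : Fin (n+1)) :
    (absorb rho S ^ t) i j = if j = i then 1 else 0 := by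
  induction t with
  | zero => simp [Matrix.one_apply, eq_comm]
  | succ t ih => simp [pow_succ', Matrix.mul_apply, absorb_apply_of_mem h hi, ih]

theorem tendsto_absorb_pow (h : IsMCCM lam rho) {S : Finset (Fin (n+1))} {j : Fin (n+1)}
    (hj : j ∈ insert 0 S) (i : Fin (n+1)) :
    Tendsto (fun t : ℕ => (absorb rho S ^ t) i j) atTop (nhds (condProb rho S i j)) := by
  have hst (t : ℕ) := pow_mem (absorb_mem_rowStochastic h S) t
  have hmono : Monotone fun t : ℕ => (absorb rho S ^ t) i j := by
    refine monotone_nat_of_le_succ fun t => ?_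
    rw [pow_succ, Matrix.mul_apply]
    calc (absorb rho S ^ t) i j = (absorb rho S ^ t) i j * absorb rho S j j := by
          simp [absorb_apply_of_mem h hj]
      _ ≤ _ := Finset.single_le_sum (f := fun k => (absorb rho S ^ t) i k * absorb rho S k j)
          (fun k _ => mul_nonneg (nonneg_of_mem_rowStochastic (hst t))
            (nonneg_of_mem_rowStochastic (absorb_mem_rowStochastic h S))) (Finset.mem_univ j)
  have hbdd : BddAbove (Set.range fun t : ℕ => (absorb rho S ^ t) i j) :=
    ⟨1, Set.forall_mem_range.2 fun t => le_one_of_mem_rowStochastic (hst t)⟩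
  exact tendsto_nhds_limUnder ⟨_, tendsto_atTop_ciSup hmono hbdd⟩

theorem hvec_apply_of_mem (h : IsMCCM lam rho) {S : Finset (Fin (n+1))} {k : Fin (n+1)}
    (hk : k ∈ insert 0 S) (j : Fin (n+1)) : hvec rho S j k = if j = k then 1 else 0 := by
  simp only [hvec, condProb, absorb_pow_apply_of_mem h hk]
  exact tendsto_const_nhds.limUnder_eq

theorem hvec_mem_harmonicOff (h : IsMCCM lam rho) {S : Finset (Fin (n+1))} {j : Fin (n+1)}
    (hj : j ∈ insert 0 S) : hvec rho S j ∈ harmonicOff rho S := by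
  intro k hk
  have h1 := (tendsto_add_atTop_iff_nat 1).2 (tendsto_absorb_pow h hj k)
  simp only [pow_succ', Matrix.mul_apply, absorb_apply_of_notMem hk] at h1
  exact tendsto_nhds_unique
    (tendsto_finsetSum _ fun l _ => (tendsto_absorb_pow h hj l).const_mul (rho k l)) h1

theorem card_add_one_le_finrank_span_hvec (h : IsMCCM lam rho) {S : Finset (Fin (n+1))}
    (hS0 : (0 : Fin (n+1)) ∉ S) :
    S.card + 1 ≤ Module.finrank ℝ ↥(Submodule.span ℝ
      {x : Fin (n+1) → ℝ | ∃ j ∈ insert (0 : Fin (n+1)) S, x = hvec rho S j}) := by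
  have hli : LinearIndependent ℝ fun j : ↥(insert 0 S) => hvec rho S j := by
    apply LinearIndependent.of_comp
      (LinearMap.funLeft ℝ ℝ (Subtype.val : ↥(insert 0 S) → Fin (n+1)))
    convert Pi.linearIndependent_single_one (↥(insert 0 S)) ℝ using 1
    funext j k
    rw [Function.comp_apply, LinearMap.funLeft_apply, hvec_apply_of_mem h k.2, Pi.single_apply]
    simp only [Subtype.coe_inj, eq_comm]
  have hcard := finrank_span_eq_card hli
  rw [Fintype.card_coe, Finset.card_insert_of_notMem hS0] at hcard
  rw [← hcard]
  refine Submodule.finrank_mono (Submodule.span_mono ?_)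
  rintro _ ⟨j, rfl⟩
  exact ⟨j, j.2, rfl⟩

end ChoiceModel

/-- (General case.)  For a family `𝒮` of nonempty assortments and a
further nonempty assortment `S'`, with `V_𝒮 = Span{h_{j,S} : S ∈ 𝒮, j ∈ S₊}` and
`V_{S'} = Span{h_{j,S'} : j ∈ S'₊}` in `ℝ^{n+1}`, one has
`dim(V_𝒮 + V_{S'}) ≥ dim V_𝒮 + |S'| − max{1, |(⋃_{S∈𝒮} S) ∩ S'|}`. -/
theorem mccm_dim_multiple_assortments_general {n : ℕ} (hn : 2 ≤ n)
    (lam : Fin (n+1) → ℝ) (rho : Matrix (Fin (n+1)) (Fin (n+1)) ℝ)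
    (h : IsMCCM lam rho)
    (𝓢 : Finset (Finset (Fin (n+1))))
    (h𝓢 : ∀ S ∈ 𝓢, (0 : Fin (n+1)) ∉ S ∧ S.Nonempty)
    (S' : Finset (Fin (n+1))) (hS'0 : (0 : Fin (n+1)) ∉ S') (hS'ne : S'.Nonempty) :
    (Module.finrank ℝ
        ↥(Submodule.span ℝ
            {x : Fin (n+1) → ℝ | ∃ S ∈ 𝓢, ∃ j ∈ insert (0 : Fin (n+1)) S, x = hvec rho S j} ⊔
          Submodule.span ℝ
            {x : Fin (n+1) → ℝ | ∃ j ∈ insert (0 : Fin (n+1)) S', x = hvec rho S' j}) : ℤ) ≥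
      (Module.finrank ℝ
        ↥(Submodule.span ℝ
            {x : Fin (n+1) → ℝ | ∃ S ∈ 𝓢, ∃ j ∈ insert (0 : Fin (n+1)) S, x = hvec rho S j}) : ℤ) +
        (S'.card : ℤ) - (max 1 ((𝓢.sup id ∩ S').card) : ℤ) := by
  set V := Submodule.span ℝ
    {x : Fin (n+1) → ℝ | ∃ S ∈ 𝓢, ∃ j ∈ insert (0 : Fin (n+1)) S, x = hvec rho S j}
  set V' := Submodule.span ℝ
    {x : Fin (n+1) → ℝ | ∃ j ∈ insert (0 : Fin (n+1)) S', x = hvec rho S' j}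
  have hV : V ≤ harmonicOff rho (𝓢.sup id) := by
    refine Submodule.span_le.2 ?_
    rintro _ ⟨S, hS, j, hj, rfl⟩
    exact harmonicOff_mono (Finset.le_sup (f := id) hS) (hvec_mem_harmonicOff h hj)
  have hV' : V' ≤ harmonicOff rho S' := by
    refine Submodule.span_le.2 ?_
    rintro _ ⟨j, hj, rfl⟩
    exact hvec_mem_harmonicOff h hj
  have hinf : Module.finrank ℝ ↥(V ⊓ V') ≤ max 1 (𝓢.sup id ∩ S').card + 1 :=
    (Submodule.finrank_mono ((inf_le_inf hV hV').trans (harmonicOff_inf_le _ _))).trans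
      (finrank_harmonicOff_le_max h (by omega) fun h0 => hS'0 (Finset.mem_inter.1 h0).2)
  have hdim : S'.card + 1 ≤ Module.finrank ℝ V' := card_add_one_le_finrank_span_hvec h hS'0
  have hsum := Submodule.finrank_sup_add_finrank_inf_eq V V'
  omega
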